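/- arXiv:1607.05285 — 4 statements merged into one kernel-verified Lean document; each statement's English description precedes it below -/
import Mathlib

section
/- Let V be a real symmetric positive definite matrix on subsystems A ⊕ B, and let γ = [[γ_B, δ],[δᵀ, γ_{B'}]] be a real symmetric positive definite matrix on subsystems B ⊕ B'. Let M be the real symmetric matrix on A ⊕ B ⊕ B' obtained as the sum of V extended by zeros on B' and γ extended by zeros on A, and let W = M/M_B be the Schur complement of the B-block of M, a matrix on A ⊕ B' whose B'-block equals γ_{B'} − δᵀ(γ_B + V_B)⁻¹δ (the image of V_B under the non-deterministic classical Gaussian map determined by γ). Then W/W_{B'} ≥ V/V_B in the Loewner order (both are matrices on subsystem A). That is, non-deterministic classical Gaussian maps in the denominator increase the Schur complement. -/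
open Matrix
open scoped ComplexOrder Kronecker

noncomputable section

/-- The standard symplectic form on a single mode. -/
def J2 : Matrix (Fin 2) (Fin 2) ℝ := !![0, 1; -1, 0]

/-- The standard symplectic form on `n` modes: the direct sum of `n` copies of
`[[0,1],[-1,0]]`, realized on the index type `Fin n × Fin 2`. -/
def Omega (n : ℕ) : Matrix (Fin n × Fin 2) (Fin n × Fin 2) ℝ :=
  (1 : Matrix (Fin n) (Fin n) ℝ) ⊗ₖ J2

/-- `V` is a quantum covariance matrix with respect to the symplectic form `Om`:
the complex matrix `V + i·Om` is positive semidefinite. -/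
def QCM {ι : Type*} [Fintype ι] (Om V : Matrix ι ι ℝ) : Prop :=
  (V.map Complex.ofReal + Complex.I • Om.map Complex.ofReal).PosSemidef

/-- The positive semidefinite square root of a positive semidefinite matrix
(the definition of the older Mathlib, since removed there). -/
def Matrix.PosSemidef.sqrt {n 𝕜 : Type*} [Fintype n] [RCLike 𝕜] [DecidableEq n]
    {A : Matrix n n 𝕜} (hA : A.PosSemidef) : Matrix n n 𝕜 :=
  hA.1.eigenvectorUnitary.1 * diagonal ((↑) ∘ Real.sqrt ∘ hA.1.eigenvalues) *
    (star hA.1.eigenvectorUnitary : Matrix n n 𝕜)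

/-- The positive semidefinite square root of a positive semidefinite real matrix
(junk value `0` if the matrix is not positive semidefinite). -/
def msqrt {ι : Type*} [Fintype ι] [DecidableEq ι] (A : Matrix ι ι ℝ) : Matrix ι ι ℝ := by
  classical exact if h : A.PosSemidef then h.sqrt else 0

/-- `g₋(A) = Σ_i max(−log ν_i, 0)` where `ν_1, …, ν_n` are the symplectic eigenvalues of `A`
(w.r.t. the symplectic form `Om`), i.e. the eigenvalues of the Hermitian matrix
`i·√A·Om·√A` are exactly `±ν_1, …, ±ν_n`; equivalently, half the sum of
`max(−log |λ|, 0)` over all eigenvalues `λ` of `i·√A·Om·√A`. -/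
def gMinus {ι : Type*} [Fintype ι] [DecidableEq ι] (Om A : Matrix ι ι ℝ) : ℝ := by
  classical exact
    if h : (Complex.I • ((msqrt A * Om * msqrt A).map Complex.ofReal)).IsHermitian then
      (∑ j, max (-Real.log |h.eigenvalues j|) 0) / 2
    else 0

/-- `g₊(A) = Σ_i max(log ν_i, 0)` where `ν_1, …, ν_n` are the symplectic eigenvalues of `A`
(w.r.t. the symplectic form `Om`). -/
def gPlus {ι : Type*} [Fintype ι] [DecidableEq ι] (Om A : Matrix ι ι ℝ) : ℝ := by
  classical exact
    if h : (Complex.I • ((msqrt A * Om * msqrt A).map Complex.ofReal)).IsHermitian then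
      (∑ j, max (Real.log |h.eigenvalues j|) 0) / 2
    else 0

/-- Schur complement of the first (upper-left) diagonal block of a block matrix:
`M/M₁₁ = M₂₂ − M₂₁ M₁₁⁻¹ M₁₂`. -/
def schurA {a b : Type*} [Fintype a] [DecidableEq a]
    (M : Matrix (a ⊕ b) (a ⊕ b) ℝ) : Matrix b b ℝ :=
  M.toBlocks₂₂ - M.toBlocks₂₁ * M.toBlocks₁₁⁻¹ * M.toBlocks₁₂

/-- Schur complement of the second (lower-right) diagonal block of a block matrix:
`M/M₂₂ = M₁₁ − M₁₂ M₂₂⁻¹ M₂₁`. -/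
def schurB {a b : Type*} [Fintype b] [DecidableEq b]
    (M : Matrix (a ⊕ b) (a ⊕ b) ℝ) : Matrix a a ℝ :=
  M.toBlocks₁₁ - M.toBlocks₁₂ * M.toBlocks₂₂⁻¹ * M.toBlocks₂₁

/-- Embedding of the `A ⊕ C` indices into `A ⊕ (B ⊕ C)`. -/
def embAC {a b c : Type*} : a ⊕ c → a ⊕ (b ⊕ c) :=
  Sum.elim Sum.inl (Sum.inr ∘ Sum.inr)

/-- Embedding of the `A ⊕ B` indices into `A ⊕ (B ⊕ C)`. -/
def embAB {a b c : Type*} : a ⊕ b → a ⊕ (b ⊕ c) :=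
  Sum.elim Sum.inl (Sum.inr ∘ Sum.inl)


/-- Extension of a matrix by zeros, along a partial identification `p` of the
ambient index set `ι` with the index set `κ` of the given matrix. -/
def extendZero {ι κ : Type*} (p : ι → Option κ) (V : Matrix κ κ ℝ) : Matrix ι ι ℝ :=
  Matrix.of fun i j =>
    match p i, p j with
    | some i', some j' => V i' j'
    | _, _ => 0

/-- Partial identification of `(A ⊕ B') ⊕ B` with `A ⊕ B` (used to extend a matrix
on `A ⊕ B` by zeros on `B'`). -/
def pV {a b b' : Type*} : (a ⊕ b') ⊕ b → Option (a ⊕ b)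
  | .inl (.inl x) => some (.inl x)
  | .inl (.inr _) => none
  | .inr x => some (.inr x)

/-- Partial identification of `(A ⊕ B') ⊕ B` with `B ⊕ B'` (used to extend a matrix
on `B ⊕ B'` by zeros on `A`). -/
def pG {a b b' : Type*} : (a ⊕ b') ⊕ b → Option (b ⊕ b')
  | .inl (.inl _) => none
  | .inl (.inr x) => some (.inr x)
  | .inr x => some (.inl x)

theorem blk_herm {a b : Type*} {M : Matrix (a ⊕ b) (a ⊕ b) ℝ} (h : M.IsHermitian) :
    M = fromBlocks M.toBlocks₁₁ M.toBlocks₁₂ M.toBlocks₁₂ᴴ M.toBlocks₂₂ := by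
  have h21 : M.toBlocks₂₁ = M.toBlocks₁₂ᴴ := by
    ext i j
    have := congrFun (congrFun h (Sum.inr i)) (Sum.inl j)
    simpa [toBlocks₂₁, toBlocks₁₂, conjTranspose_apply] using this.symm
  rw [← h21, fromBlocks_toBlocks]

theorem schurB_iff {a b : Type*} [Fintype a] [Fintype b] [DecidableEq b]
    {M : Matrix (a ⊕ b) (a ⊕ b) ℝ} (h : M.IsHermitian) (hB : M.toBlocks₂₂.PosDef) :
    M.PosSemidef ↔ (schurB M).PosSemidef := by
  have e := blk_herm h
  have h21 : M.toBlocks₂₁ = M.toBlocks₁₂ᴴ := by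
    conv_lhs => rw [e]
    simp
  have := hB.isUnit.invertible
  have := PosDef.fromBlocks₂₂ M.toBlocks₁₁ M.toBlocks₁₂ hB
  rw [← e, ← h21] at this
  exact this

theorem schurB_sub {a b : Type*} [Fintype b] [DecidableEq b]
    (M : Matrix (a ⊕ b) (a ⊕ b) ℝ) (S : Matrix a a ℝ) :
    schurB (M - fromBlocks S 0 0 0) = schurB M - S := by
  have h11 : (M - fromBlocks S 0 0 0).toBlocks₁₁ = M.toBlocks₁₁ - S := by ext; simp [toBlocks₁₁]
  have h12 : (M - fromBlocks S 0 0 0).toBlocks₁₂ = M.toBlocks₁₂ := by ext; simp [toBlocks₁₂]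
  have h21 : (M - fromBlocks S 0 0 0).toBlocks₂₁ = M.toBlocks₂₁ := by ext; simp [toBlocks₂₁]
  have h22 : (M - fromBlocks S 0 0 0).toBlocks₂₂ = M.toBlocks₂₂ := by ext; simp [toBlocks₂₂]
  rw [schurB, h11, h12, h21, h22, schurB]
  abel

theorem toBlocks22_posDef {a b : Type*} [Fintype a] [Fintype b]
    {M : Matrix (a ⊕ b) (a ⊕ b) ℝ} (h : M.PosDef) : M.toBlocks₂₂.PosDef :=
  h.submatrix Sum.inr_injective

theorem schurB_posDef {a b : Type*} [Fintype a] [Fintype b] [DecidableEq a] [DecidableEq b]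
    {M : Matrix (a ⊕ b) (a ⊕ b) ℝ} (h : M.PosDef) : (schurB M).PosDef := by
  have hB := toBlocks22_posDef h
  have hs := (schurB_iff h.1 hB).1 h.posSemidef
  refine hs.posDef_iff_isUnit.2 ?_
  have := hB.isUnit.invertible
  have hd := det_fromBlocks₂₂ M.toBlocks₁₁ M.toBlocks₁₂ M.toBlocks₂₁ M.toBlocks₂₂
  rw [fromBlocks_toBlocks, invOf_eq_nonsing_inv] at hd
  rw [isUnit_iff_isUnit_det, isUnit_iff_ne_zero]
  intro h0
  have := h.det_pos
  rw [hd] at this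
  unfold schurB at h0
  rw [h0] at this
  simp at this

theorem sub_schurB_posSemidef {a b : Type*} [Fintype a] [Fintype b] [DecidableEq a]
    [DecidableEq b] {M : Matrix (a ⊕ b) (a ⊕ b) ℝ} (h : M.PosDef) :
    (M - fromBlocks (schurB M) 0 0 0).PosSemidef := by
  have hs := schurB_posDef h
  have h22 : (M - fromBlocks (schurB M) 0 0 0).toBlocks₂₂ = M.toBlocks₂₂ := by
    ext; simp [toBlocks₂₂]
  rw [schurB_iff, schurB_sub, sub_self]
  · exact PosSemidef.zero
  · exact h.1.sub (IsHermitian.fromBlocks hs.1 (by simp) isHermitian_zero)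
  · rw [h22]; exact toBlocks22_posDef h

theorem extendZero_posSemidef {ι κ : Type*} [Fintype ι] [Fintype κ] [DecidableEq κ]
    (p : ι → Option κ) {V : Matrix κ κ ℝ} (h : V.PosSemidef) :
    (extendZero p V).PosSemidef := by
  have := h.conjTranspose_mul_mul_same (Matrix.of fun k i => if p i = some k then (1:ℝ) else 0)
  convert this using 1
  ext i j
  simp only [extendZero, of_apply, mul_apply, conjTranspose_apply]
  cases hi : p i <;> cases hj : p j <;> simp

theorem ext_sub {a b c : Type*} (V : Matrix (a ⊕ b) (a ⊕ b) ℝ)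
    (γ : Matrix (b ⊕ c) (b ⊕ c) ℝ) (S : Matrix a a ℝ) :
    extendZero (pV (b' := c)) V + extendZero (pG (a := a)) γ
        - fromBlocks (fromBlocks S 0 0 0) 0 0 0
      = extendZero (pV (b' := c)) (V - fromBlocks S 0 0 0)
        + extendZero (pG (a := a)) γ := by
  ext ((i | i) | i) ((j | j) | j) <;> simp [extendZero, pV, pG]

theorem main_gen {a b c : Type*} [Fintype a] [Fintype b] [Fintype c] [DecidableEq a]
    [DecidableEq b] [DecidableEq c] (V : Matrix (a ⊕ b) (a ⊕ b) ℝ)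
    (γ : Matrix (b ⊕ c) (b ⊕ c) ℝ) (hV : V.PosDef) (hγ : γ.PosDef) :
    (schurB (schurB (extendZero (pV (b' := c)) V + extendZero (pG (a := a)) γ))
      - schurB V).PosSemidef := by
  set M := extendZero (pV (b' := c)) V + extendZero (pG (a := a)) γ with hM
  have hMs : M.PosSemidef :=
    (extendZero_posSemidef _ hV.posSemidef).add (extendZero_posSemidef _ hγ.posSemidef)
  have hMB : M.toBlocks₂₂.PosDef := by
    have : M.toBlocks₂₂ = V.toBlocks₂₂ + γ.submatrix Sum.inl Sum.inl := by
      ext i j; simp [hM, extendZero, pV, pG, toBlocks₂₂]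
    rw [this]
    exact (toBlocks22_posDef hV).add (hγ.submatrix Sum.inl_injective)
  have hN : (M.submatrix (Sum.map Sum.inr id : c ⊕ b → (a ⊕ c) ⊕ b)
      (Sum.map Sum.inr id)).PosDef := by
    have : M.submatrix (Sum.map Sum.inr id : c ⊕ b → (a ⊕ c) ⊕ b) (Sum.map Sum.inr id)
        = γ.submatrix Sum.swap Sum.swap + (extendZero (pV (b' := c)) V).submatrix
          (Sum.map Sum.inr id) (Sum.map Sum.inr id) := by
      ext (i | i) (j | j) <;> simp [hM, extendZero, pV, pG, add_comm]
    rw [this]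
    exact (hγ.submatrix Sum.swap_leftInverse.injective).add_posSemidef
      ((extendZero_posSemidef _ hV.posSemidef).submatrix _)
  have hWB : (schurB M).toBlocks₂₂.PosDef := schurB_posDef hN
  have e1 : M - fromBlocks (fromBlocks (schurB V) 0 0 0) 0 0 0
      = extendZero (pV (b' := c)) (V - fromBlocks (schurB V) 0 0 0)
        + extendZero (pG (a := a)) γ := by
    rw [hM, ext_sub]
  have hP : (M - fromBlocks (fromBlocks (schurB V) 0 0 0) 0 0 0).PosSemidef := by
    rw [e1]
    exact (extendZero_posSemidef _ (sub_schurB_posSemidef hV)).add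
      (extendZero_posSemidef _ hγ.posSemidef)
  have hP2 : (schurB M - fromBlocks (schurB V) 0 0 0).PosSemidef := by
    rw [← schurB_sub]
    refine (schurB_iff hP.1 ?_).1 hP
    convert hMB using 1
    ext; simp [toBlocks₂₂]
  rw [← schurB_sub]
  refine (schurB_iff hP2.1 ?_).1 hP2
  convert hWB using 1
  ext; simp [toBlocks₂₂]

/-- **Theorem 2 (Classical Gaussian maps in the denominator increase Schur complement).**
Let `V > 0` on `A ⊕ B` and `γ > 0` on `B ⊕ B'` be real symmetric positive definite, let
`M` on `(A ⊕ B') ⊕ B` be the sum of `V` extended by zeros on `B'` and `γ` extended by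
zeros on `A`, and let `W = M/M_B` (a matrix on `A ⊕ B'`, whose `B'` block is the image of
`V_B` under the classical Gaussian map determined by `γ`). Then `W/W_{B'} ≥ V/V_B`. -/
theorem gaussian_map_increases_schur (nA nB nB' : ℕ)
    (V : Matrix ((Fin nA × Fin 2) ⊕ (Fin nB × Fin 2))
        ((Fin nA × Fin 2) ⊕ (Fin nB × Fin 2)) ℝ)
    (γ : Matrix ((Fin nB × Fin 2) ⊕ (Fin nB' × Fin 2))
        ((Fin nB × Fin 2) ⊕ (Fin nB' × Fin 2)) ℝ)
    (hVsymm : V.IsSymm) (hVpd : V.PosDef) (hγsymm : γ.IsSymm) (hγpd : γ.PosDef) :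
    (schurB (schurB (extendZero (pV (b' := Fin nB' × Fin 2)) V
        + extendZero (pG (a := Fin nA × Fin 2)) γ))
      - schurB V).PosSemidef := by
  exact main_gen V γ hVpd hγpd

end
end

section
/- Let V be a real symmetric positive definite matrix on three subsystems A, B, C that is symplectic, i.e., V Ω Vᵀ = Ω where Ω = Ω_{n_A} ⊕ Ω_{n_B} ⊕ Ω_{n_C}. Then V_{AB}/V_B = Ω_{n_A}ᵀ (V_{AC}/V_C)⁻¹ Ω_{n_A}, where V_{AB}/V_B and V_{AC}/V_C denote Schur complements of the B-block and C-block in the corresponding principal submatrices. -/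
open Matrix
open scoped ComplexOrder Kronecker

noncomputable section

lemma schur_core {a b c : Type*} [Fintype a] [Fintype b] [Fintype c]
    [DecidableEq a] [DecidableEq b] [DecidableEq c]
    (OA : Matrix a a ℝ) (OB : Matrix b b ℝ) (OC : Matrix c c ℝ)
    (A : Matrix a a ℝ) (X : Matrix a b ℝ) (Y : Matrix a c ℝ)
    (X' : Matrix b a ℝ) (B Bi : Matrix b b ℝ)
    (Y' : Matrix c a ℝ) (Z' : Matrix c b ℝ) (C Ci : Matrix c c ℝ)
    (hB : B * Bi = 1) (hC : Ci * C = 1)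
    (e1 : A * OA * A + X * OB * X' + Y * OC * Y' = OA)
    (e2 : A * OA * X + X * OB * B + Y * OC * Z' = 0)
    (e3 : Y' * OA * A + Z' * OB * X' + C * OC * Y' = 0)
    (e4 : Y' * OA * X + Z' * OB * B + C * OC * Z' = 0) :
    (A - Y * Ci * Y') * OA * (A - X * Bi * X') = OA := by
  have h1 : A * OA * A = OA - X * OB * X' - Y * OC * Y' := by
    conv_rhs => rw [← e1]
    abel
  have h2 : A * OA * X = - (X * OB * B) - Y * OC * Z' := by
    rw [← sub_eq_zero, ← e2]; abel
  have h3 : Y' * OA * A = - (Z' * OB * X') - C * OC * Y' := by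
    rw [← sub_eq_zero, ← e3]; abel
  have h4 : Y' * OA * X = - (Z' * OB * B) - C * OC * Z' := by
    rw [← sub_eq_zero, ← e4]; abel
  have hB' : ∀ M : Matrix b a ℝ, B * (Bi * M) = M := fun M => by
    rw [← Matrix.mul_assoc, hB, Matrix.one_mul]
  have hC' : ∀ M : Matrix c a ℝ, Ci * (C * M) = M := fun M => by
    rw [← Matrix.mul_assoc, hC, Matrix.one_mul]
  have : (A - Y * Ci * Y') * OA * (A - X * Bi * X') = A * OA * A - A * OA * X * (Bi * X')
      - Y * Ci * (Y' * OA * A) + Y * Ci * (Y' * OA * X) * (Bi * X') := by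
    simp only [Matrix.sub_mul, Matrix.mul_sub, Matrix.mul_assoc]; abel
  rw [this, h1, h2, h3, h4]
  simp only [Matrix.sub_mul, Matrix.mul_sub, Matrix.neg_mul, Matrix.mul_neg, Matrix.mul_assoc,
    hB', hC']
  abel

lemma Omega_mul_transpose (n : ℕ) : Omega n * (Omega n)ᵀ = 1 := by
  have : J2 * J2ᵀ = 1 := by
    ext i j; fin_cases i <;> fin_cases j <;> simp [J2, Matrix.mul_apply]
  rw [Omega, ← kroneckerMap_transpose, ← Matrix.mul_kronecker_mul, this]
  simp

/-- **Symplectic purification identity.** If `V > 0` is a real symmetric positive definite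
symplectic matrix on `A ⊕ (B ⊕ C)` (i.e. `V Ω Vᵀ = Ω`), then
`V_{AB}/V_B = Ω_Aᵀ (V_{AC}/V_C)⁻¹ Ω_A`. -/
theorem symplectic_schur_identity (nA nB nC : ℕ)
    (V : Matrix ((Fin nA × Fin 2) ⊕ ((Fin nB × Fin 2) ⊕ (Fin nC × Fin 2)))
        ((Fin nA × Fin 2) ⊕ ((Fin nB × Fin 2) ⊕ (Fin nC × Fin 2))) ℝ)
    (hVsymm : V.IsSymm) (hVpd : V.PosDef)
    (hsymp : V * fromBlocks (Omega nA) 0 0 (fromBlocks (Omega nB) 0 0 (Omega nC)) * Vᵀ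
      = fromBlocks (Omega nA) 0 0 (fromBlocks (Omega nB) 0 0 (Omega nC))) :
    schurB (V.submatrix (embAB (c := Fin nC × Fin 2)) (embAB (c := Fin nC × Fin 2)))
      = (Omega nA)ᵀ
        * (schurB (V.submatrix (embAC (b := Fin nB × Fin 2))
            (embAC (b := Fin nB × Fin 2))))⁻¹
        * Omega nA := by
  rw [hVsymm.eq] at hsymp
  have hΩ := Omega_mul_transpose nA
  have hΩ' := mul_eq_one_comm.mp hΩ
  set A : Matrix (Fin nA × Fin 2) (Fin nA × Fin 2) ℝ :=
    V.submatrix Sum.inl Sum.inl with hA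
  set B : Matrix (Fin nB × Fin 2) (Fin nB × Fin 2) ℝ :=
    V.submatrix (Sum.inr ∘ Sum.inl) (Sum.inr ∘ Sum.inl) with hB
  set C : Matrix (Fin nC × Fin 2) (Fin nC × Fin 2) ℝ :=
    V.submatrix (Sum.inr ∘ Sum.inr) (Sum.inr ∘ Sum.inr) with hC
  have hBpd : B.PosDef := hVpd.submatrix (Sum.inr_injective.comp Sum.inl_injective)
  have hCpd : C.PosDef := hVpd.submatrix (Sum.inr_injective.comp Sum.inr_injective)
  have hBi : B * B⁻¹ = 1 := Matrix.mul_nonsing_inv _ ((Matrix.isUnit_iff_isUnit_det _).mp hBpd.isUnit)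
  have hCi : C⁻¹ * C = 1 := Matrix.nonsing_inv_mul _ ((Matrix.isUnit_iff_isUnit_det _).mp hCpd.isUnit)
  have key := schur_core (Omega nA) (Omega nB) (Omega nC) A
    (V.submatrix Sum.inl (Sum.inr ∘ Sum.inl)) (V.submatrix Sum.inl (Sum.inr ∘ Sum.inr))
    (V.submatrix (Sum.inr ∘ Sum.inl) Sum.inl) B B⁻¹
    (V.submatrix (Sum.inr ∘ Sum.inr) Sum.inl)
    (V.submatrix (Sum.inr ∘ Sum.inr) (Sum.inr ∘ Sum.inl)) C C⁻¹ hBi hCi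
    (by
      ext i j
      have := congrFun (congrFun hsymp (Sum.inl i)) (Sum.inl j)
      simpa [Matrix.mul_apply, Fintype.sum_sum_type, hA, hB, hC, add_assoc] using this)
    (by
      ext i j
      have := congrFun (congrFun hsymp (Sum.inl i)) (Sum.inr (Sum.inl j))
      simpa [Matrix.mul_apply, Fintype.sum_sum_type, hA, hB, hC, add_assoc] using this)
    (by
      ext i j
      have := congrFun (congrFun hsymp (Sum.inr (Sum.inr i))) (Sum.inl j)
      simpa [Matrix.mul_apply, Fintype.sum_sum_type, hA, hB, hC, add_assoc] using this)
    (by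
      ext i j
      have := congrFun (congrFun hsymp (Sum.inr (Sum.inr i))) (Sum.inr (Sum.inl j))
      simpa [Matrix.mul_apply, Fintype.sum_sum_type, hA, hB, hC, add_assoc] using this)
  change schurB (V.submatrix embAC embAC) * Omega nA * schurB (V.submatrix embAB embAB)
    = Omega nA at key
  generalize schurB (V.submatrix (embAC (b := Fin nB × Fin 2)) embAC) = S at key ⊢
  generalize schurB (V.submatrix (embAB (c := Fin nC × Fin 2)) embAB) = T at key ⊢
  have hS : S * (Omega nA * T * (Omega nA)ᵀ) = 1 := by
    rw [← Matrix.mul_assoc, ← Matrix.mul_assoc, key, hΩ]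
  rw [Matrix.inv_eq_right_inv hS]
  simp only [Matrix.mul_assoc, hΩ', Matrix.mul_one]
  rw [← Matrix.mul_assoc, hΩ', Matrix.one_mul]

end
end

section
/- Let ρ be a complex positive semidefinite matrix on the tensor product ℂ^{d_B} ⊗ ℂ^{d_C} with Tr ρ = 1, and let (ψ_i)_{i∈I} be a finite family of vectors in ℂ^{d_C} satisfying the completeness relation Σ_i ψ_i ψ_i† = 1 (the d_C×d_C identity). Suppose there exist a complex positive semidefinite matrix σ on ℂ^{d_B} with Tr σ = 1, nonnegative real numbers p_i, and unitary matrices U_i on ℂ^{d_B} such that (1_B ⊗ ψ_i)† ρ (1_B ⊗ ψ_i) = p_i · U_i† σ U_i for every i, where 1_B ⊗ ψ_i denotes the (d_B d_C)×d_B matrix given by the Kronecker product of the identity on ℂ^{d_B} with the column vector ψ_i. Then Tr σ² ≥ Tr ρ². -/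
open Matrix
open scoped ComplexOrder Kronecker

noncomputable section

/-- The partial pairing `(1_B ⊗ ψ)† ρ (1_B ⊗ ψ)` of a matrix `ρ` on `ℂ^{d_B} ⊗ ℂ^{d_C}`
with a vector `ψ ∈ ℂ^{d_C}`, a `d_B × d_B` matrix. -/
def partialPair {dB dC : ℕ}
    (ρ : Matrix (Fin dB × Fin dC) (Fin dB × Fin dC) ℂ) (ψ : Fin dC → ℂ) :
    Matrix (Fin dB) (Fin dB) ℂ :=
  Matrix.of fun a a' => ∑ c : Fin dC, ∑ c' : Fin dC,
    (starRingEnd ℂ) (ψ c) * ρ (a, c) (a', c') * ψ c'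

/-- The matrix `1_B ⊗ ψ`. -/
def purKet (dB : ℕ) {dC : ℕ} (ψ : Fin dC → ℂ) : Matrix (Fin dB × Fin dC) (Fin dB) ℂ :=
  Matrix.of fun x a => if x.1 = a then ψ x.2 else 0

lemma pur_partialPair_eq {dB dC : ℕ}
    (ρ : Matrix (Fin dB × Fin dC) (Fin dB × Fin dC) ℂ) (ψ : Fin dC → ℂ) :
    partialPair ρ ψ = (purKet dB ψ)ᴴ * ρ * purKet dB ψ := by
  ext a a'
  simp only [partialPair, purKet, Matrix.mul_apply, Matrix.of_apply, Matrix.conjTranspose_apply,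
    Fintype.sum_prod_type, apply_ite star, star_zero, ite_mul, mul_ite, zero_mul, mul_zero,
    Finset.sum_mul]
  rw [Finset.sum_comm]
  simp [Finset.sum_ite_irrel]

lemma pur_ket_sum {dB dC : ℕ} {I : Type*} [Fintype I] (ψ : I → (Fin dC → ℂ))
    (hcomplete : ∑ i : I, Matrix.of (fun c c' => ψ i c * (starRingEnd ℂ) (ψ i c'))
      = (1 : Matrix (Fin dC) (Fin dC) ℂ)) :
    ∑ i, (purKet dB (ψ i)) * (purKet dB (ψ i))ᴴ = 1 := by
  ext ⟨a, c⟩ ⟨a', c'⟩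
  have h := congrFun (congrFun hcomplete c) c'
  simp only [Matrix.sum_apply, Matrix.of_apply] at h
  by_cases haa : a = a'
  · subst haa
    simp [Matrix.sum_apply, purKet, Matrix.mul_apply, Matrix.one_apply] at h ⊢
    exact h
  · have : ¬ a' = a := fun h => haa h.symm
    simp [Matrix.sum_apply, purKet, Matrix.mul_apply, Matrix.one_apply, haa, this, apply_ite]

open scoped Matrix.Norms.Frobenius in
lemma pur_norm_sq {n : Type*} [Fintype n] (A : Matrix n n ℂ) (hA : Aᴴ = A) :
    (A * A).trace.re = ‖A‖ ^ 2 := by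
  have h : (A * A).trace = (A * Aᴴ).trace := by rw [hA]
  rw [h, Matrix.frobenius_norm_def, ← Real.sqrt_eq_rpow, Real.sq_sqrt (by positivity)]
  simp [Matrix.trace, Matrix.mul_apply, Complex.mul_conj, Complex.normSq_eq_norm_sq]
  norm_cast

/-- **Purity increases under rank-one measurements with unitarily equivalent outcomes.**
If `ρ ≥ 0` with `Tr ρ = 1` on `ℂ^{d_B} ⊗ ℂ^{d_C}`, `(ψ_i)` is a finite family of vectors
of `ℂ^{d_C}` with `Σ_i ψ_i ψ_i† = 1`, and there are `σ ≥ 0` with `Tr σ = 1`, `p_i ≥ 0`,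
and unitaries `U_i` with `(1_B ⊗ ψ_i)† ρ (1_B ⊗ ψ_i) = p_i · U_i† σ U_i` for all `i`,
then `Tr σ² ≥ Tr ρ²`. -/
theorem purity_increases_rank_one_measurement (dB dC : ℕ) {I : Type*} [Fintype I]
    (ρ : Matrix (Fin dB × Fin dC) (Fin dB × Fin dC) ℂ)
    (hρ : ρ.PosSemidef) (hρtr : ρ.trace = 1)
    (ψ : I → (Fin dC → ℂ))
    (hcomplete : ∑ i : I, Matrix.of (fun c c' => ψ i c * (starRingEnd ℂ) (ψ i c'))
      = (1 : Matrix (Fin dC) (Fin dC) ℂ))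
    (σ : Matrix (Fin dB) (Fin dB) ℂ) (hσ : σ.PosSemidef) (hσtr : σ.trace = 1)
    (p : I → ℝ) (hp : ∀ i, 0 ≤ p i)
    (U : I → Matrix (Fin dB) (Fin dB) ℂ)
    (hU : ∀ i, U i ∈ Matrix.unitaryGroup (Fin dB) ℂ)
    (houtcome : ∀ i, partialPair ρ (ψ i) = (p i : ℂ) • ((U i)ᴴ * σ * U i)) :
    (ρ * ρ).trace.re ≤ (σ * σ).trace.re := by
  open scoped Matrix.Norms.Frobenius in
  obtain ⟨B, hB⟩ : ∃ B : Matrix (Fin dB × Fin dC) (Fin dB × Fin dC) ℂ, ρ = Bᴴ * B := by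
    open scoped MatrixOrder in
    exact CStarAlgebra.nonneg_iff_eq_star_mul_self.1 hρ.nonneg
  have hK := pur_ket_sum (dB := dB) ψ hcomplete
  set X : I → Matrix (Fin dB × Fin dC) (Fin dB) ℂ := fun i => B * purKet dB (ψ i) with hX
  set P : I → Matrix (Fin dB × Fin dC) (Fin dB × Fin dC) ℂ := fun i => X i * (X i)ᴴ with hP
  have hsum : ∑ i, P i = B * Bᴴ := by
    have : ∀ i, P i = B * (purKet dB (ψ i) * (purKet dB (ψ i))ᴴ) * Bᴴ := fun i => by
      simp [hP, hX, Matrix.conjTranspose_mul, Matrix.mul_assoc]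
    simp_rw [this]
    rw [← Finset.sum_mul, ← Finset.mul_sum, hK, Matrix.mul_one]
  have hXX : ∀ i, (X i)ᴴ * X i = (p i : ℂ) • ((U i)ᴴ * σ * U i) := fun i => by
    rw [← houtcome, pur_partialPair_eq, hB]
    simp [hX, Matrix.conjTranspose_mul, Matrix.mul_assoc]
  have hUU : ∀ i, U i * (U i)ᴴ = 1 := fun i => Matrix.mem_unitaryGroup_iff.1 (hU i)
  have hPtr : ∀ i, (P i).trace = p i := fun i => by
    simp only [hP]
    rw [Matrix.trace_mul_comm, hXX, Matrix.trace_smul, Matrix.trace_mul_comm,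
      ← Matrix.mul_assoc, hUU, Matrix.one_mul, hσtr]
    simp
  have hpsum : ∑ i, p i = 1 := by
    have h1 : (∑ i, P i).trace = 1 := by
      rw [hsum, Matrix.trace_mul_comm, ← hB, hρtr]
    rw [Matrix.trace_sum] at h1
    simp_rw [hPtr] at h1
    exact_mod_cast h1
  have hPP : ∀ i, (P i * P i).trace = (p i : ℂ) ^ 2 * (σ * σ).trace := fun i => by
    have e1 : (P i * P i).trace = (((X i)ᴴ * X i) * ((X i)ᴴ * X i)).trace := by
      simp only [hP]
      rw [Matrix.mul_assoc, Matrix.trace_mul_comm]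
      simp only [Matrix.mul_assoc]
    have e2 : ((U i)ᴴ * σ * U i) * ((U i)ᴴ * σ * U i) = (U i)ᴴ * (σ * σ * U i) := by
      calc _ = (U i)ᴴ * σ * (U i * (U i)ᴴ) * σ * U i := by simp only [Matrix.mul_assoc]
        _ = _ := by rw [hUU, Matrix.mul_one]; simp only [Matrix.mul_assoc]
    rw [e1, hXX, Matrix.smul_mul, Matrix.mul_smul, e2, Matrix.trace_smul, Matrix.trace_smul,
      Matrix.trace_mul_comm, Matrix.mul_assoc, hUU, Matrix.mul_one]
    simp only [smul_eq_mul]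
    ring
  have hσn := pur_norm_sq σ hσ.1
  have hPn : ∀ i, ‖P i‖ = p i * ‖σ‖ := fun i => by
    have h1 := pur_norm_sq (P i) (by simp [hP])
    rw [hPP, ← Complex.ofReal_pow, Complex.re_ofReal_mul, hσn, ← mul_pow] at h1
    exact ((sq_eq_sq₀ (mul_nonneg (hp i) (norm_nonneg _)) (norm_nonneg _)).1 h1).symm
  have hle : ‖B * Bᴴ‖ ≤ ‖σ‖ := by
    rw [← hsum]
    refine (norm_sum_le _ _).trans ?_
    simp_rw [hPn]
    rw [← Finset.sum_mul, hpsum, one_mul]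
  have hfin : (ρ * ρ).trace = ((B * Bᴴ) * (B * Bᴴ)).trace := by
    rw [hB, Matrix.mul_assoc, Matrix.trace_mul_comm]
    simp only [Matrix.mul_assoc]
  rw [hfin, pur_norm_sq _ (by simp), hσn]
  gcongr


end
end

section
/- Gaussian Rényi-2 entanglement is at most half the Rényi-2 mutual information: let V be a real symmetric positive definite quantum covariance matrix on two subsystems A ⊕ B (V + i·(Ω_{n_A} ⊕ Ω_{n_B}) positive semidefinite). Then there exists a real symmetric positive definite symplectic matrix γ on A ⊕ B with γ ≤ V and (det γ_A)² ≤ (det V_A · det V_B) / det V, where γ_A, V_A, V_B denote the indicated diagonal principal submatrices. (Equivalently, E_2(A:B) = inf over pure quantum CMs γ ≤ V of ½ log det γ_A is at most ½ I_2(A:B) = ¼ log(det V_A det V_B / det V).) -/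
open Matrix
open scoped ComplexOrder Kronecker

noncomputable section

section Aux

open scoped MatrixOrder

variable {ι : Type*} [Fintype ι] [DecidableEq ι]

lemma exists_posDef_sqrt {A : Matrix ι ι ℝ} (hA : A.PosDef) :
    ∃ S : Matrix ι ι ℝ, S.PosDef ∧ S * S = A := by
  have h0 : 0 ≤ A := hA.posSemidef.nonneg
  have hS : CFC.sqrt A * CFC.sqrt A = A := CFC.sqrt_mul_sqrt_self A h0
  refine ⟨CFC.sqrt A, ?_, hS⟩
  have hp : (CFC.sqrt A).PosSemidef := (CFC.sqrt_nonneg A).posSemidef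
  rw [hp.posDef_iff_det_ne_zero]
  intro h
  have h1 : A.det = 0 := by rw [← hS, det_mul, h, zero_mul]
  exact hA.det_pos.ne' h1

lemma posDef_sqrt_unique {S T : Matrix ι ι ℝ} (hS : S.PosDef) (hT : T.PosDef)
    (h : S * S = T * T) : S = T :=
  (CFC.mul_self_eq_mul_self_iff S T hS.posSemidef.nonneg hT.posSemidef.nonneg).1 h

lemma one_le_det_of_one_le {M : Matrix ι ι ℝ} (h : (M - 1).PosSemidef) : 1 ≤ M.det := by
  have hM : M.IsHermitian := by
    have := h.1.add (isHermitian_one (n := ι) (α := ℝ))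
    simpa using this
  rw [hM.det_eq_prod_eigenvalues]
  have : ∀ i, 1 ≤ hM.eigenvalues i := by
    intro i
    have h1 := h.dotProduct_mulVec_nonneg (hM.eigenvectorBasis i)
    have h2 := hM.mulVec_eigenvectorBasis i
    rw [sub_mulVec, h2, one_mulVec, dotProduct_sub, dotProduct_smul] at h1
    have h3 : star (hM.eigenvectorBasis i : ι → ℝ) ⬝ᵥ (hM.eigenvectorBasis i : ι → ℝ) = 1 := by
      have := hM.eigenvectorBasis.orthonormal.1 i
      rw [EuclideanSpace.norm_eq, Real.sqrt_eq_one] at this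
      simpa [dotProduct, sq] using this
    rw [h3] at h1
    simpa using h1
  have h4 := Finset.prod_le_prod (s := Finset.univ) (f := fun _ : ι => (1 : ℝ))
    (g := hM.eigenvalues) (fun _ _ => zero_le_one) (fun i _ => this i)
  simpa using h4

lemma det_le_det_of_le {A B : Matrix ι ι ℝ} (hA : A.PosDef) (h : (B - A).PosSemidef) :
    A.det ≤ B.det := by
  obtain ⟨R, hR, hRA⟩ := exists_posDef_sqrt hA
  have hu : IsUnit R.det := hR.det_pos.ne'.isUnit
  have h1 := h.conjTranspose_mul_mul_same R⁻¹
  rw [hR.inv.1.eq] at h1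
  have h2 : R⁻¹ * (B - A) * R⁻¹ = R⁻¹ * B * R⁻¹ - 1 := by
    rw [mul_sub, sub_mul, ← hRA, ← mul_assoc R⁻¹, nonsing_inv_mul _ hu, one_mul,
      mul_nonsing_inv _ hu]
  rw [h2] at h1
  have h3 := one_le_det_of_one_le h1
  rw [det_mul, det_mul, det_nonsing_inv, Ring.inverse_eq_inv'] at h3
  rw [← hRA, det_mul]
  have hp := hR.det_pos
  have : R.det⁻¹ * B.det * R.det⁻¹ = B.det / (R.det * R.det) := by field_simp
  rw [this, one_le_div (by positivity)] at h3
  exact h3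

lemma real_herm {A : Matrix ι ι ℝ} (h : A.IsHermitian) : Aᵀ = A := by
  simpa [IsHermitian, conjTranspose_eq_transpose_of_trivial] using h

lemma herm_of_symm {A : Matrix ι ι ℝ} (h : Aᵀ = A) : A.IsHermitian := by
  simpa [IsHermitian, conjTranspose_eq_transpose_of_trivial] using h

/-- uncertainty relation on real vectors -/
lemma qcm_real {J V : Matrix ι ι ℝ} (hJ : Jᵀ = -J) (hV : Vᵀ = V) (h : QCM J V) (x y : ι → ℝ) :
    2 * (x ⬝ᵥ (J *ᵥ y)) ≤ x ⬝ᵥ (V *ᵥ x) + y ⬝ᵥ (V *ᵥ y) := by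
  have h1 := h.dotProduct_mulVec_nonneg (fun i => (x i : ℂ) + Complex.I * (y i : ℂ))
  have h2 := (Complex.le_def.1 h1).1
  have hJ' : y ⬝ᵥ (J *ᵥ x) = - (x ⬝ᵥ (J *ᵥ y)) := by
    rw [dotProduct_mulVec, ← mulVec_transpose, hJ, neg_mulVec, neg_dotProduct, dotProduct_comm]
  have h3 : (star (fun i => (x i : ℂ) + Complex.I * (y i : ℂ)) ⬝ᵥ
      ((V.map Complex.ofReal + Complex.I • J.map Complex.ofReal) *ᵥ
        (fun i => (x i : ℂ) + Complex.I * (y i : ℂ)))).re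
      = x ⬝ᵥ (V *ᵥ x) + y ⬝ᵥ (V *ᵥ y) - x ⬝ᵥ (J *ᵥ y) + y ⬝ᵥ (J *ᵥ x) := by
    simp only [dotProduct, mulVec, Finset.mul_sum, Complex.re_sum, ← Finset.sum_add_distrib,
      ← Finset.sum_sub_distrib]
    refine Finset.sum_congr rfl fun i _ => Finset.sum_congr rfl fun j _ => ?_
    simp
    ring
  rw [h3, hJ'] at h2
  simp only [Complex.zero_re] at h2
  linarith

lemma le_of_qcm {J V : Matrix ι ι ℝ} (hJ : Jᵀ = -J) (hV : V.PosDef) (h : QCM J V) :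
    (V - J * V⁻¹ * Jᵀ).PosSemidef := by
  have hVs := real_herm hV.1
  have hVi := real_herm hV.inv.1
  have hu : IsUnit V.det := hV.det_pos.ne'.isUnit
  refine .of_dotProduct_mulVec_nonneg (herm_of_symm ?_) fun x => ?_
  · simp only [transpose_sub, transpose_mul, transpose_transpose, hVs, hVi, mul_assoc]
  · have h1 := qcm_real hJ hVs h x (V⁻¹ *ᵥ (Jᵀ *ᵥ x))
    have e1 : x ⬝ᵥ (J *ᵥ (V⁻¹ *ᵥ (Jᵀ *ᵥ x))) = x ⬝ᵥ ((J * V⁻¹ * Jᵀ) *ᵥ x) := by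
      simp only [mulVec_mulVec, mul_assoc]
    have e2 : (V⁻¹ *ᵥ (Jᵀ *ᵥ x)) ⬝ᵥ (V *ᵥ (V⁻¹ *ᵥ (Jᵀ *ᵥ x)))
        = x ⬝ᵥ ((J * V⁻¹ * Jᵀ) *ᵥ x) := by
      rw [mulVec_mulVec _ V, mul_nonsing_inv _ hu, one_mulVec, ← e1, dotProduct_mulVec x,
        ← mulVec_transpose, dotProduct_comm]
    rw [e1, e2] at h1
    rw [sub_mulVec, dotProduct_sub, star_trivial]
    linarith

lemma exists_geom {J V : Matrix ι ι ℝ} (hJ : Jᵀ = -J) (hJJ : J * J = -1) (hV : V.PosDef)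
    (h : QCM J V) : ∃ γ : Matrix ι ι ℝ, γ.PosDef ∧ γ * V⁻¹ * γ = J * V⁻¹ * Jᵀ ∧
      γ * J * γᵀ = J ∧ (V - γ).PosSemidef := by
  have hJt : J * Jᵀ = 1 := by rw [hJ, mul_neg, hJJ, neg_neg]
  have hJt' : Jᵀ * J = 1 := by rw [hJ, neg_mul, hJJ, neg_neg]
  have hJu : IsUnit J := IsUnit.of_mul_eq_one _ hJt
  have conjJ : ∀ {M : Matrix ι ι ℝ}, M.PosDef → (J * M * Jᵀ).PosDef := by
    intro M hM
    have := (IsUnit.posDef_star_right_conjugate_iff (x := M) hJu).2 hM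
    simpa [star_eq_conjTranspose, conjTranspose_eq_transpose_of_trivial] using this
  have hW := conjJ hV.inv
  have hWV := le_of_qcm hJ hV h
  obtain ⟨R, hR, hRV⟩ := exists_posDef_sqrt hV
  have hu : IsUnit R.det := hR.det_pos.ne'.isUnit
  have r1 : R * R⁻¹ = 1 := mul_nonsing_inv _ hu
  have r2 : R⁻¹ * R = 1 := nonsing_inv_mul _ hu
  have hVi : V⁻¹ = R⁻¹ * R⁻¹ := by rw [← hRV, Matrix.mul_inv_rev]
  have conjR : ∀ {M : Matrix ι ι ℝ}, M.PosDef → (R * M * R).PosDef := by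
    intro M hM
    have := (IsUnit.posDef_star_right_conjugate_iff (x := M) hR.isUnit).2 hM
    rwa [star_eq_conjTranspose, hR.1.eq] at this
  have conjRi : ∀ {M : Matrix ι ι ℝ}, M.PosDef → (R⁻¹ * M * R⁻¹).PosDef := by
    intro M hM
    have := (IsUnit.posDef_star_right_conjugate_iff (x := M) hR.inv.isUnit).2 hM
    rwa [star_eq_conjTranspose, hR.inv.1.eq] at this
  obtain ⟨X, hX, hXX⟩ := exists_posDef_sqrt (conjRi hW)
  have can : ∀ M N : Matrix ι ι ℝ, M * R * (R⁻¹ * N) = M * N := by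
    intro M N; rw [mul_assoc, ← mul_assoc R, r1, one_mul]
  have can' : ∀ M N : Matrix ι ι ℝ, M * R⁻¹ * (R * N) = M * N := by
    intro M N; rw [mul_assoc, ← mul_assoc R⁻¹, r2, one_mul]
  set W := J * V⁻¹ * Jᵀ with hWdef
  have hγ := conjR hX
  set γ := R * X * R with hγdef
  have hric : γ * V⁻¹ * γ = W := by
    have : γ * V⁻¹ * γ = R * (X * X) * R := by
      rw [hγdef, hVi]
      calc R * X * R * (R⁻¹ * R⁻¹) * (R * X * R)
          = R * X * (R * R⁻¹) * (R⁻¹ * R) * X * R := by simp only [mul_assoc]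
        _ = _ := by rw [r1, r2]; simp only [mul_assoc, one_mul]
    rw [this, hXX]
    calc R * (R⁻¹ * W * R⁻¹) * R = (R * R⁻¹) * W * (R⁻¹ * R) := by simp only [mul_assoc]
      _ = W := by rw [r1, r2, one_mul, mul_one]
  -- uniqueness
  have huniq : ∀ δ : Matrix ι ι ℝ, δ.PosDef → δ * V⁻¹ * δ = W → δ = γ := by
    intro δ hδ hδW
    have hY := conjRi hδ
    have : (R⁻¹ * δ * R⁻¹) * (R⁻¹ * δ * R⁻¹) = X * X := by
      rw [hXX, ← hδW, hVi]; simp only [mul_assoc]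
    have := posDef_sqrt_unique hY hX this
    rw [hγdef, ← this]
    calc δ = (R * R⁻¹) * δ * (R⁻¹ * R) := by rw [r1, r2, one_mul, mul_one]
      _ = _ := by simp only [mul_assoc]
  have hug : IsUnit γ.det := hγ.det_pos.ne'.isUnit
  have hsym : J * γ⁻¹ * Jᵀ = γ := by
    apply huniq _ (conjJ hγ.inv)
    have e1 : Jᵀ * V⁻¹ * J = γ * V⁻¹ * γ := by
      rw [hric, hWdef, hJ]; simp
    calc J * γ⁻¹ * Jᵀ * V⁻¹ * (J * γ⁻¹ * Jᵀ) = J * γ⁻¹ * (Jᵀ * V⁻¹ * J) * γ⁻¹ * Jᵀ := by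
          simp only [mul_assoc]
      _ = J * (γ⁻¹ * γ) * V⁻¹ * (γ * γ⁻¹) * Jᵀ := by rw [e1]; simp only [mul_assoc]
      _ = W := by rw [nonsing_inv_mul _ hug, mul_nonsing_inv _ hug, mul_one, mul_one]
  refine ⟨γ, hγ, hric, ?_, ?_⟩
  · rw [real_herm hγ.1]
    calc γ * J * γ = (J * γ⁻¹ * Jᵀ) * J * γ := by rw [hsym]
      _ = J * γ⁻¹ * (Jᵀ * J) * γ := by simp only [mul_assoc]
      _ = J * (γ⁻¹ * γ) := by rw [hJt']; simp only [mul_assoc, one_mul]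
      _ = J := by rw [nonsing_inv_mul _ hug, mul_one]
  · have h1 : (1 - X * X).PosSemidef := by
      have := hWV.mul_mul_conjTranspose_same R⁻¹
      rw [hR.inv.1.eq, mul_sub, sub_mul, ← hXX, ← hRV, ← mul_assoc R⁻¹, r2, one_mul, r1] at this
      exact this
    have h2 : ((1 - X) * (1 - X)).PosSemidef := by
      have hH : (1 - X).IsHermitian := isHermitian_one.sub hX.1
      have := posSemidef_conjTranspose_mul_self (1 - X)
      rwa [hH.eq] at this
    have h3 : (1 - X).PosSemidef := by
      have := (h1.add h2).smul (α := ℝ) (a := 1/2) (by norm_num)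
      have e : (1/2 : ℝ) • ((1 - X * X) + (1 - X) * (1 - X)) = 1 - X := by
        have : (1 - X * X) + (1 - X) * (1 - X) = (2 : ℝ) • (1 - X) := by
          rw [two_smul]; noncomm_ring
        rw [this, smul_smul]; norm_num
      rwa [e] at this
    have := h3.mul_mul_conjTranspose_same R
    rw [hR.1.eq, mul_sub, sub_mul, mul_one, hRV] at this
    exact this

end Aux

lemma det_block_sq {a b : Type*} [Fintype a] [DecidableEq a] [Fintype b] [DecidableEq b]
    {V W γ : Matrix (a ⊕ b) (a ⊕ b) ℝ} (hV : V.PosDef) (hγ : γ.PosDef)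
    (h : γ * V⁻¹ * γ = W) :
    γ.toBlocks₁₁.det ^ 2 ≤ V.toBlocks₁₁.det * W.toBlocks₁₁.det := by
  have huV : IsUnit V.det := hV.det_pos.ne'.isUnit
  have hVA : V.toBlocks₁₁.PosDef := hV.submatrix Sum.inl_injective
  have hγA : γ.toBlocks₁₁.PosDef := hγ.submatrix Sum.inl_injective
  haveI : Invertible V := invertibleOfIsUnitDet V huV
  haveI : Invertible V.toBlocks₁₁ := invertibleOfIsUnitDet _ hVA.det_pos.ne'.isUnit
  have hb : (fromBlocks V γ γᴴ W).PosSemidef := by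
    rw [PosDef.fromBlocks₁₁ γ W hV, hγ.1.eq, h, sub_self]
    exact PosSemidef.zero
  have hb2 := hb.submatrix (Sum.map (Sum.inl : a → a ⊕ b) (Sum.inl : a → a ⊕ b))
  have e : (fromBlocks V γ γᴴ W).submatrix (Sum.map (Sum.inl : a → a ⊕ b) (Sum.inl : a → a ⊕ b))
        (Sum.map (Sum.inl : a → a ⊕ b) (Sum.inl : a → a ⊕ b))
      = fromBlocks V.toBlocks₁₁ γ.toBlocks₁₁ γ.toBlocks₁₁ᴴ W.toBlocks₁₁ := by
    ext i j
    rcases i with i | i <;> rcases j with j | j <;> rfl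
  rw [e, PosDef.fromBlocks₁₁ _ _ hVA, hγA.1.eq] at hb2
  have hpd : (γ.toBlocks₁₁ * V.toBlocks₁₁⁻¹ * γ.toBlocks₁₁).PosDef := by
    have := (IsUnit.posDef_star_right_conjugate_iff (x := V.toBlocks₁₁⁻¹) hγA.isUnit).2 hVA.inv
    rwa [star_eq_conjTranspose, hγA.1.eq] at this
  have := det_le_det_of_le hpd hb2
  rw [det_mul, det_mul, det_nonsing_inv, Ring.inverse_eq_inv'] at this
  have hp := hVA.det_pos
  calc γ.toBlocks₁₁.det ^ 2 = V.toBlocks₁₁.det *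
        (γ.toBlocks₁₁.det * (V.toBlocks₁₁.det)⁻¹ * γ.toBlocks₁₁.det) := by field_simp
    _ ≤ _ := by gcongr

lemma det_inv_block {a b : Type*} [Fintype a] [DecidableEq a] [Fintype b] [DecidableEq b]
    {V : Matrix (a ⊕ b) (a ⊕ b) ℝ} (hV : V.PosDef) :
    V⁻¹.toBlocks₁₁.det = V.toBlocks₂₂.det / V.det := by
  have hVB : V.toBlocks₂₂.PosDef := hV.submatrix Sum.inr_injective
  have huV : IsUnit V.det := hV.det_pos.ne'.isUnit
  -- V * [[P, 0],[Q, 1]] = [[1, V12],[0, V22]]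
  have h1 : V * fromBlocks V⁻¹.toBlocks₁₁ 0 V⁻¹.toBlocks₂₁ 1
      = fromBlocks 1 V.toBlocks₁₂ 0 V.toBlocks₂₂ := by
    have h2 : V * V⁻¹ = 1 := mul_nonsing_inv _ huV
    have h3 : fromBlocks V.toBlocks₁₁ V.toBlocks₁₂ V.toBlocks₂₁ V.toBlocks₂₂ *
      fromBlocks V⁻¹.toBlocks₁₁ V⁻¹.toBlocks₁₂ V⁻¹.toBlocks₂₁ V⁻¹.toBlocks₂₂ = 1 := by
      simpa only [fromBlocks_toBlocks] using h2
    rw [fromBlocks_multiply, ← fromBlocks_one, fromBlocks_inj] at h3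
    conv_lhs => rw [← fromBlocks_toBlocks V]
    rw [fromBlocks_multiply]
    simp only [fromBlocks_toBlocks, h3.1, h3.2.2.1, Matrix.mul_zero, Matrix.mul_one, zero_add]
  have h2 := congrArg det h1
  rw [det_mul, det_fromBlocks_zero₁₂, det_fromBlocks_zero₂₁, det_one, det_one, mul_one,
    one_mul] at h2
  rw [← h2, mul_div_cancel_left₀ _ hV.det_pos.ne']

lemma J2_transpose : J2ᵀ = -J2 := by
  ext i j; fin_cases i <;> fin_cases j <;> simp [J2]

lemma J2_sq : J2 * J2 = -1 := by
  ext i j; fin_cases i <;> fin_cases j <;> simp [J2]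

lemma Omega_transpose (n : ℕ) : (Omega n)ᵀ = -Omega n := by
  ext ⟨i, k⟩ ⟨j, l⟩
  have := congrFun (congrFun J2_transpose k) l
  simp only [transpose_apply, neg_apply] at this
  simp [Omega, this, Matrix.one_apply, eq_comm]

lemma Omega_sq (n : ℕ) : Omega n * Omega n = -1 := by
  rw [Omega, ← mul_kronecker_mul, J2_sq, one_mul]
  have h : (-1 : Matrix (Fin 2) (Fin 2) ℝ) = (-1 : ℝ) • (1 : Matrix (Fin 2) (Fin 2) ℝ) := by simp
  rw [h, kronecker_smul, one_kronecker_one]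
  simp

/-- **Rényi-2 entanglement is at most half the Rényi-2 mutual information.** For a real
symmetric positive definite quantum covariance matrix `V` on `A ⊕ B`, there is a real
symmetric positive definite symplectic `γ ≤ V` with
`(det γ_A)² ≤ (det V_A · det V_B)/det V`. -/
theorem renyi2_entanglement_le_half_mutual_information (nA nB : ℕ)
    (V : Matrix ((Fin nA × Fin 2) ⊕ (Fin nB × Fin 2))
        ((Fin nA × Fin 2) ⊕ (Fin nB × Fin 2)) ℝ)
    (hVsymm : V.IsSymm) (hVpd : V.PosDef)
    (hQCM : QCM (fromBlocks (Omega nA) 0 0 (Omega nB)) V) :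
    ∃ γ : Matrix ((Fin nA × Fin 2) ⊕ (Fin nB × Fin 2))
        ((Fin nA × Fin 2) ⊕ (Fin nB × Fin 2)) ℝ,
      γ.IsSymm ∧ γ.PosDef ∧
      γ * fromBlocks (Omega nA) 0 0 (Omega nB) * γᵀ
        = fromBlocks (Omega nA) 0 0 (Omega nB) ∧
      (V - γ).PosSemidef ∧
      γ.toBlocks₁₁.det ^ 2 ≤ (V.toBlocks₁₁.det * V.toBlocks₂₂.det) / V.det := by
  set J := fromBlocks (Omega nA) 0 0 (Omega nB) with hJdef
  have hJ : Jᵀ = -J := by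
    rw [hJdef, fromBlocks_transpose, fromBlocks_neg, Omega_transpose, Omega_transpose]; simp
  have hJJ : J * J = -1 := by
    rw [hJdef, fromBlocks_multiply, ← fromBlocks_one, fromBlocks_neg]
    simp [Omega_sq]
  obtain ⟨γ, hγ, hric, hsymp, hle⟩ := exists_geom hJ hJJ hVpd hQCM
  refine ⟨γ, real_herm hγ.1, hγ, hsymp, hle, ?_⟩
  have h1 := det_block_sq hVpd hγ hric
  have h2 : (J * V⁻¹ * Jᵀ).toBlocks₁₁ = Omega nA * V⁻¹.toBlocks₁₁ * (Omega nA)ᵀ := by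
    conv_lhs => rw [← fromBlocks_toBlocks V⁻¹]
    rw [hJdef, fromBlocks_transpose, fromBlocks_multiply, fromBlocks_multiply,
      toBlocks_fromBlocks₁₁]
    simp
  have h3 : (Omega nA).det * (Omega nA)ᵀ.det = 1 := by
    rw [← det_mul, Omega_transpose, mul_neg, Omega_sq, neg_neg, det_one]
  have h4 : (J * V⁻¹ * Jᵀ).toBlocks₁₁.det = V.toBlocks₂₂.det / V.det := by
    rw [h2, det_mul, det_mul, ← det_inv_block hVpd, mul_right_comm, h3, one_mul]
  rw [h4] at h1
  rwa [mul_div_assoc]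

end
end
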